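/- Given any K > 0, one can choose constants α₁, α₂ > 0 such that P(D ∈ A₁(α₁,α₂)ᶜ) < e^{−K log n} for all n sufficiently large; that is, the probability that some D_i deviates from its mean by more than √(α₁ log n) below or √(α₂ log n) above is at most n^{−K}. -/

import Mathlib

open Filter Real

/-- The unnormalized weight `f(k,γ) = (1/k!) exp(-βk² + γ k log n)`. -/
noncomputable def degWeight (β γ : ℝ) (n : ℕ) (k : ℕ) : ℝ :=
  (1 / (Nat.factorial k : ℝ)) * Real.exp (-β * (k : ℝ) ^ 2 + γ * Real.log n * k)

/-- The probability mass function of `D₁`: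
`P(D₁ = k) = F(γ)⁻¹ (1/k!) exp(-βk² + γ (log n) k)`. -/
noncomputable def degPMF (β γ : ℝ) (n : ℕ) (k : ℕ) : ℝ :=
  degWeight β γ n k / (∑' j : ℕ, degWeight β γ n j)

/-- The mean `E[D₁]`. -/
noncomputable def degMean (β γ : ℝ) (n : ℕ) : ℝ :=
  ∑' k : ℕ, (k : ℝ) * degPMF β γ n k

/-- The variance `Var(D₁)`. -/
noncomputable def degVar (β γ : ℝ) (n : ℕ) : ℝ :=
  ∑' k : ℕ, ((k : ℝ) - degMean β γ n) ^ 2 * degPMF β γ n k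

lemma degWeight_pos (β γ : ℝ) (n k : ℕ) : 0 < degWeight β γ n k := by
  unfold degWeight; positivity

/-- The ratio of consecutive weights. -/
noncomputable def degRatio (β γ : ℝ) (n k : ℕ) : ℝ :=
  Real.exp (γ * Real.log n - β * (2 * k + 1)) / (k + 1)

lemma degRatio_pos (β γ : ℝ) (n k : ℕ) : 0 < degRatio β γ n k := by
  unfold degRatio; positivity

lemma degWeight_succ (β γ : ℝ) (n k : ℕ) :
    degWeight β γ n (k + 1) = degWeight β γ n k * degRatio β γ n k := by
  unfold degWeight degRatio
  have hexp : -β * ((k + 1 : ℕ) : ℝ) ^ 2 + γ * Real.log n * ((k + 1 : ℕ) : ℝ)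
      = (-β * (k : ℝ) ^ 2 + γ * Real.log n * k) + (γ * Real.log n - β * (2 * k + 1)) := by
    push_cast; ring
  rw [hexp, Real.exp_add, Nat.factorial_succ]
  push_cast
  field_simp

lemma degRatio_add_le (β γ : ℝ) (n k j : ℕ) :
    degRatio β γ n (k + j) ≤ degRatio β γ n k * Real.exp (-(2 * β * j)) := by
  unfold degRatio
  have hexp : γ * Real.log n - β * (2 * ((k + j : ℕ) : ℝ) + 1)
      = (γ * Real.log n - β * (2 * k + 1)) + -(2 * β * j) := by
    push_cast; ring
  rw [hexp, Real.exp_add, div_mul_eq_mul_div]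
  gcongr
  simp

lemma summable_degWeight {β : ℝ} (hβ : 0 ≤ β) (γ : ℝ) (n : ℕ) :
    Summable (degWeight β γ n) := by
  refine Summable.of_nonneg_of_le (fun k => (degWeight_pos β γ n k).le) (fun k => ?_)
    (Real.summable_pow_div_factorial (Real.exp (γ * Real.log n)))
  unfold degWeight
  rw [← Real.exp_nat_mul, one_div_mul_eq_div]
  gcongr
  nlinarith [mul_nonneg hβ (sq_nonneg (k : ℝ))]

/-- There is a mode `m` around which the weights decay like a Gaussian, uniformly in the tilt. -/
lemma exists_degWeight_le {β : ℝ} (hβ : 0 ≤ β) (γ : ℝ) (n : ℕ) :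
    ∃ m : ℕ, ∀ k : ℕ, degWeight β γ n k ≤ degWeight β γ n m *
      Real.exp (-β * (((k : ℝ) - m) ^ 2 - |(k : ℝ) - m|)) := by
  have hex : ∃ k, degRatio β γ n k ≤ 1 := by
    by_contra! hcon
    have hone : ∀ k, 1 ≤ degWeight β γ n k := by
      intro k
      induction k with
      | zero => simp [degWeight]
      | succ k ih =>
        rw [degWeight_succ]
        exact one_le_mul_of_one_le_of_one_le ih (hcon k).le
    have hlim := (summable_degWeight hβ γ n).tendsto_atTop_zero
    exact absurd (ge_of_tendsto' hlim hone) (by norm_num)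
  classical
  obtain ⟨m, hm, hmin⟩ : ∃ m, degRatio β γ n m ≤ 1 ∧ ∀ k < m, 1 < degRatio β γ n k :=
    ⟨Nat.find hex, Nat.find_spec hex, fun k hk => not_le.1 (Nat.find_min hex hk)⟩
  have up : ∀ j : ℕ, degWeight β γ n (m + j) ≤
      degWeight β γ n m * Real.exp (-β * ((j : ℝ) ^ 2 - j)) := by
    intro j
    induction j with
    | zero => simp
    | succ j ih =>
      have hr : degRatio β γ n (m + j) ≤ Real.exp (-(2 * β * j)) :=
        (degRatio_add_le β γ n m j).trans (mul_le_of_le_one_left (Real.exp_pos _).le hm)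
      rw [← add_assoc, degWeight_succ]
      calc _ ≤ (degWeight β γ n m * Real.exp (-β * ((j : ℝ) ^ 2 - j))) *
            Real.exp (-(2 * β * j)) :=
            mul_le_mul ih hr (degRatio_pos _ _ _ _).le
              (mul_nonneg (degWeight_pos _ _ _ _).le (Real.exp_pos _).le)
        _ = _ := by
            rw [mul_assoc, ← Real.exp_add]
            congr 2
            push_cast; ring
  have down : ∀ j a : ℕ, a + j = m → degWeight β γ n a ≤
      degWeight β γ n m * Real.exp (-β * ((j : ℝ) ^ 2 - j)) := by
    intro j
    induction j with
    | zero => rintro a rfl; simp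
    | succ j ih =>
      intro a ha
      have ih' := ih (a + 1) (by omega)
      have hr : 1 ≤ degRatio β γ n a * Real.exp (-(2 * β * j)) :=
        (hmin (a + j) (by omega)).le.trans (degRatio_add_le β γ n a j)
      calc degWeight β γ n a
          ≤ degWeight β γ n a * (degRatio β γ n a * Real.exp (-(2 * β * j))) :=
            le_mul_of_one_le_right (degWeight_pos _ _ _ _).le hr
        _ = degWeight β γ n (a + 1) * Real.exp (-(2 * β * j)) := by
            rw [degWeight_succ, mul_assoc (degWeight β γ n a)]
        _ ≤ (degWeight β γ n m * Real.exp (-β * ((j : ℝ) ^ 2 - j))) *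
            Real.exp (-(2 * β * j)) := by gcongr
        _ = _ := by
            rw [mul_assoc, ← Real.exp_add]
            congr 2
            push_cast; ring
  refine ⟨m, fun k => ?_⟩
  rcases le_total m k with h | h
  · obtain ⟨j, rfl⟩ := Nat.exists_eq_add_of_le h
    simpa using up j
  · obtain ⟨j, rfl⟩ := Nat.exists_eq_add_of_le h
    simpa using down j k rfl

lemma degPMF_nonneg (β γ : ℝ) (n k : ℕ) : 0 ≤ degPMF β γ n k :=
  div_nonneg (degWeight_pos _ _ _ _).le (tsum_nonneg fun j => (degWeight_pos β γ n j).le)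

lemma sum_degPMF_le_one {β : ℝ} (hβ : 0 ≤ β) (γ : ℝ) (n : ℕ) (s : Finset ℕ) :
    ∑ k ∈ s, degPMF β γ n k ≤ 1 := by
  unfold degPMF
  rw [← Finset.sum_div]
  exact div_le_one_of_le₀
    ((summable_degWeight hβ γ n).sum_le_tsum s fun j _ => (degWeight_pos β γ n j).le)
    (tsum_nonneg fun j => (degWeight_pos β γ n j).le)

lemma exists_degPMF_le {β : ℝ} (hβ : 0 ≤ β) (γ : ℝ) (n : ℕ) :
    ∃ m : ℕ, ∀ k : ℕ, degPMF β γ n k ≤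
      Real.exp (-β * (((k : ℝ) - m) ^ 2 - |(k : ℝ) - m|)) := by
  obtain ⟨m, hm⟩ := exists_degWeight_le hβ γ n
  refine ⟨m, fun k => ?_⟩
  have hle : degWeight β γ n m ≤ ∑' j, degWeight β γ n j :=
    (summable_degWeight hβ γ n).le_tsum m fun j _ => (degWeight_pos β γ n j).le
  unfold degPMF
  rw [div_le_iff₀ ((degWeight_pos β γ n m).trans_le hle), mul_comm]
  exact (hm k).trans (by gcongr)

lemma summable_exp_neg_half_sq_sub_abs {β : ℝ} (hβ : 0 < β) :
    Summable fun z : ℤ => Real.exp (-β * ((z : ℝ) ^ 2 / 2 - |(z : ℝ)|)) := by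
  have key : Summable fun k : ℕ => Real.exp (-β * ((k : ℝ) ^ 2 / 2 - k)) := by
    refine Summable.of_nonneg_of_le (fun k => (Real.exp_pos _).le) (fun k => ?_)
      (Real.summable_exp_neg_nat.mul_left (Real.exp ((β + 1) ^ 2 / (2 * β))))
    rw [← Real.exp_add]
    gcongr
    have hsq : (β + 1) ^ 2 / (2 * β) + -(k : ℝ) - -β * ((k : ℝ) ^ 2 / 2 - k)
        = (β * k - (β + 1)) ^ 2 / (2 * β) := by
      field_simp; ring
    have : 0 ≤ (β * k - (β + 1)) ^ 2 / (2 * β) := by positivity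
    linarith
  refine summable_int_iff_summable_nat_and_neg.2 ⟨?_, ?_⟩ <;> simpa using key

/-- A Gaussian tail bound around the mode, with a constant that is uniform in `γ` and `n`. -/
lemma exists_sum_degPMF_tail_le {β : ℝ} (hβ : 0 < β) :
    ∃ C : ℝ, ∀ (γ : ℝ) (n : ℕ), ∃ m : ℕ, ∀ R : ℝ, 0 ≤ R → ∀ s : Finset ℕ,
      (∑ k ∈ s, if R < |(k : ℝ) - m| then degPMF β γ n k else 0) ≤
        C * Real.exp (-(β / 2 * R ^ 2)) := by
  set h : ℤ → ℝ := fun z => Real.exp (-β * ((z : ℝ) ^ 2 / 2 - |(z : ℝ)|)) with hh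
  have hs : Summable h := summable_exp_neg_half_sq_sub_abs hβ
  refine ⟨∑' z, h z, fun γ n => ?_⟩
  obtain ⟨m, hm⟩ := exists_degPMF_le hβ.le γ n
  refine ⟨m, fun R hR s => ?_⟩
  have hinj : Function.Injective fun k : ℕ => (k : ℤ) - m := fun a b hab => by
    simpa using hab
  have hsum : ∑ k ∈ s, h ((k : ℤ) - m) ≤ ∑' z, h z :=
    ((hs.comp_injective hinj).sum_le_tsum s fun _ _ => (Real.exp_pos _).le).trans
      (tsum_comp_le_tsum_of_inj hs (fun _ => (Real.exp_pos _).le) hinj)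
  calc _ ≤ ∑ k ∈ s, h ((k : ℤ) - m) * Real.exp (-(β / 2 * R ^ 2)) := by
        refine Finset.sum_le_sum fun k _ => ?_
        split_ifs with hk
        · refine (hm k).trans ?_
          simp only [hh]
          rw [← Real.exp_add]
          gcongr
          push_cast
          have hsq : R ^ 2 ≤ ((k : ℝ) - m) ^ 2 := by
            rw [← sq_abs ((k : ℝ) - m)]; gcongr
          nlinarith
        · positivity
    _ ≤ _ := by rw [← Finset.sum_mul]; gcongr

/-- Union bound for a product of sub-probability weights. -/
lemma sum_pi_prod_le_card_mul {ι α : Type*} [Fintype ι] [DecidableEq ι] [DecidableEq α]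
    {p : α → ℝ} (hp : ∀ k, 0 ≤ p k) (B : α → Prop) [DecidablePred B] {δ : ℝ}
    (hone : ∀ s : Finset α, ∑ k ∈ s, p k ≤ 1)
    (htail : ∀ s : Finset α, (∑ k ∈ s, if B k then p k else 0) ≤ δ)
    (E : (ι → α) → Prop) [DecidablePred E] (hE : ∀ d, E d → ∃ i, B (d i))
    (S : Finset (ι → α)) :
    (∑ d ∈ S, if E d then ∏ i, p (d i) else 0) ≤ Fintype.card ι * δ := by
  set g : ι → ι → α → ℝ := fun i j k => if j = i then (if B k then p k else 0) else p k with hg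
  have hg0 : ∀ i j k, 0 ≤ g i j k := fun i j k => by
    simp only [hg]; split_ifs <;> first | exact hp k | exact le_rfl
  set t : ι → Finset α := fun i => S.image fun d => d i
  have hS : S ⊆ Fintype.piFinset t := fun d hd =>
    Fintype.mem_piFinset.2 fun i => Finset.mem_image_of_mem _ hd
  calc _ ≤ ∑ d ∈ S, ∑ i, ∏ j, g i j (d j) := by
        refine Finset.sum_le_sum fun d _ => ?_
        have hnn : ∀ i ∈ Finset.univ, 0 ≤ ∏ j, g i j (d j) := fun i _ =>
          Finset.prod_nonneg fun j _ => hg0 _ _ _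
        split_ifs with h
        · obtain ⟨i, hi⟩ := hE d h
          refine le_trans (le_of_eq ?_) (Finset.single_le_sum hnn (Finset.mem_univ i))
          refine Finset.prod_congr rfl fun j _ => ?_
          by_cases hj : j = i
          · subst hj; simp [hg, hi]
          · simp [hg, hj]
        · exact Finset.sum_nonneg hnn
    _ ≤ ∑ d ∈ Fintype.piFinset t, ∑ i, ∏ j, g i j (d j) :=
        Finset.sum_le_sum_of_subset_of_nonneg hS fun d _ _ =>
          Finset.sum_nonneg fun i _ => Finset.prod_nonneg fun j _ => hg0 _ _ _
    _ = ∑ i, ∏ j, ∑ k ∈ t j, g i j k := by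
        rw [Finset.sum_comm]
        exact Finset.sum_congr rfl fun i _ => (Finset.prod_univ_sum t (g i)).symm
    _ ≤ ∑ i : ι, ∏ j, (if j = i then δ else 1) := by
        refine Finset.sum_le_sum fun i _ => Finset.prod_le_prod
          (fun j _ => Finset.sum_nonneg fun k _ => hg0 _ _ _) fun j _ => ?_
        by_cases hj : j = i
        · simpa [hg, hj] using htail (t i)
        · simpa [hg, hj] using hone (t j)
    _ = Fintype.card ι * δ := by simp

/-- If all entries lie within `R` of `m`, they lie within `2 R` of their average. -/
lemma abs_sub_average_le {n : ℕ} {x : Fin n → ℝ} {m R : ℝ} (h : ∀ i, |x i - m| ≤ R)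
    (i : Fin n) : |x i - (∑ j, x j) / n| ≤ 2 * R := by
  have hn : (0 : ℝ) < n := by exact_mod_cast i.pos
  have havg : |(∑ j, x j) / n - m| ≤ R := by
    have : (∑ j, x j) / n - m = (∑ j, (x j - m)) / n := by
      simp [Finset.sum_sub_distrib]; field_simp
    rw [this, abs_div, abs_of_pos hn, div_le_iff₀ hn]
    refine (Finset.abs_sum_le_sum_abs _ _).trans ?_
    refine (Finset.sum_le_sum fun j _ => h j).trans ?_
    simp [mul_comm]
  have h1 := abs_le.1 (h i)
  have h2 := abs_le.1 havg
  exact abs_le.2 ⟨by linarith, by linarith⟩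

open scoped Classical in
/-- **Lemma.** Given any `K > 0`, one can choose constants `α₁, α₂ > 0` such that
`P(D ∈ A₁(α₁,α₂)ᶜ) < e^{-K log n}` for all `n` sufficiently large, where
`A₁(α₁,α₂) = {d : -√(α₁ log n) ≤ dᵢ - d̄ ≤ √(α₂ log n) for all i}`, `d̄` is the empirical
mean of the coordinates, and `D₁,…,D_n` are iid with pmf `degPMF β (γ n) n`, the tilt
`γ n` being chosen so that `E[D₁] = c log n`. -/
theorem deviation_bound (β c : ℝ) (hβ : 0 < β) (hc : 0 < c)
    (γ : ℕ → ℝ) (hγ : ∀ n, 0 < γ n)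
    (hmean : ∀ n : ℕ, 2 ≤ n → degMean β (γ n) n = c * Real.log n)
    (K : ℝ) (hK : 0 < K) :
    ∃ α₁ > (0 : ℝ), ∃ α₂ > (0 : ℝ), ∀ᶠ n : ℕ in Filter.atTop,
      (∑' d : Fin n → ℕ,
          if ¬ (∀ i : Fin n,
              -Real.sqrt (α₁ * Real.log n) ≤ (d i : ℝ) - (∑ j : Fin n, (d j : ℝ)) / n ∧
              (d i : ℝ) - (∑ j : Fin n, (d j : ℝ)) / n ≤ Real.sqrt (α₂ * Real.log n)) then
            ∏ i : Fin n, degPMF β (γ n) n (d i)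
          else 0)
        < Real.exp (-K * Real.log n) := by
  obtain ⟨C, hC⟩ := exists_sum_degPMF_tail_le hβ
  have hα : 0 < 8 * (K + 2) / β := by positivity
  refine ⟨_, hα, _, hα, ?_⟩
  filter_upwards [eventually_gt_atTop 0, tendsto_natCast_atTop_atTop.eventually_gt_atTop C]
    with n hn hnC
  have hn0 : (0 : ℝ) < n := by exact_mod_cast hn
  have hL : 0 ≤ Real.log n := Real.log_natCast_nonneg n
  obtain ⟨m, hm⟩ := hC (γ n) n
  set R : ℝ := Real.sqrt (8 * (K + 2) / β * Real.log n) / 2 with hR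
  have hR2 : β / 2 * R ^ 2 = (K + 2) * Real.log n := by
    rw [hR, div_pow, Real.sq_sqrt (by positivity)]
    field_simp; ring
  refine lt_of_le_of_lt (b := n * (C * Real.exp (-(β / 2 * R ^ 2)))) ?_ ?_
  · refine Real.tsum_le_of_sum_le (fun d => ?_) fun S => ?_
    · split_ifs
      · exact le_rfl
      · exact Finset.prod_nonneg fun i _ => degPMF_nonneg _ _ _ _
    · have hunion := sum_pi_prod_le_card_mul (ι := Fin n) (degPMF_nonneg β (γ n) n)
        (fun k => R < |(k : ℝ) - m|) (sum_degPMF_le_one hβ.le (γ n) n)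
        (hm R (by positivity)) (fun d : Fin n → ℕ => ¬ ∀ i : Fin n,
          -Real.sqrt (8 * (K + 2) / β * Real.log n) ≤ (d i : ℝ) - (∑ j : Fin n, (d j : ℝ)) / n ∧
          (d i : ℝ) - (∑ j : Fin n, (d j : ℝ)) / n ≤ Real.sqrt (8 * (K + 2) / β * Real.log n))
        (fun d hd => by
          by_contra! hcon
          refine hd fun i => abs_le.1 ((abs_sub_average_le hcon i).trans_eq ?_)
          rw [hR]; ring) S
      rw [Fintype.card_fin] at hunion
      convert hunion
  · have hexp : Real.exp (-(β / 2 * R ^ 2)) = Real.exp (-K * Real.log n) / n / n := by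
      rw [hR2, show -((K + 2) * Real.log n) = -K * Real.log n - Real.log n - Real.log n by ring,
        Real.exp_sub, Real.exp_sub, Real.exp_log hn0]
    rw [hexp, show (n : ℝ) * (C * (Real.exp (-K * Real.log n) / n / n))
      = (C / n) * Real.exp (-K * Real.log n) by field_simp]
    exact mul_lt_of_lt_one_left (Real.exp_pos _) ((div_lt_one hn0).2 hnC)
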